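/- For every classical solution (v,u,θ,w,b) of the planar compressible MHD system on ℝ × [0,T] whose initial energy e₀ is finite, one has the energy inequality: sup_{0≤t≤T} ∫_ℝ [ (u² + |w|² + v|b|²)/2 + (v − ln v − 1) + (θ − ln θ − 1) ] dx + ∫₀^T ∫_ℝ [ θ^{β−2} θ_x²/v + (μ(v)u_x² + |w_x|² + |b_x|²)/(vθ) ] dx dt ≤ e₀. -/

import Mathlib

open MeasureTheory Set Filter

noncomputable section

/-- Viscosity function `μ(z) = 1 + α z^(−α)` (here `μ̃₁ = 1`, `μ̃₂ = α`). -/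
def visc (α z : ℝ) : ℝ := 1 + α * z ^ (-α)

/-- Squared Euclidean norm on `ℝ × ℝ` (used for the transverse fields `w, b ∈ ℝ²`). -/
def sq2 (p : ℝ × ℝ) : ℝ := p.1 ^ 2 + p.2 ^ 2

/-- Partial derivative with respect to the first (spatial) variable. -/
def pdx {E : Type*} [NormedAddCommGroup E] [NormedSpace ℝ E]
    (f : ℝ → ℝ → E) (x t : ℝ) : E := deriv (fun y => f y t) x

/-- Partial derivative with respect to the second (time) variable, taken within `[0, T]`
(so it is one-sided at the endpoints). -/
def pdt (T : ℝ) {E : Type*} [NormedAddCommGroup E] [NormedSpace ℝ E]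
    (f : ℝ → ℝ → E) (x t : ℝ) : E := derivWithin (fun s => f x s) (Icc 0 T) t

/-- A classical solution of the planar compressible MHD system (in Lagrangian coordinates,
with all physical constants normalized to `1` and `μ̃₂ = α`) on `ℝ × [0,T]`:
all the derivatives appearing in the equations exist and are continuous, `v, θ > 0`,
the five equations hold pointwise, the solution tends to `(1,0,1,0,0)` as `|x| → ∞`
uniformly in `t ∈ [0,T]`, and `v−1, u, θ−1, b, w` and their first spatial derivatives
are square-integrable in `x` for each `t ∈ [0,T]`. -/
structure IsClassicalSolution (α β T : ℝ) (v u θ : ℝ → ℝ → ℝ)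
    (w b : ℝ → ℝ → ℝ × ℝ) : Prop where
  v_pos : ∀ x : ℝ, ∀ t ∈ Icc (0:ℝ) T, 0 < v x t
  θ_pos : ∀ x : ℝ, ∀ t ∈ Icc (0:ℝ) T, 0 < θ x t
  diff_x : ∀ x : ℝ, ∀ t ∈ Icc (0:ℝ) T,
    DifferentiableAt ℝ (fun y => v y t) x ∧ DifferentiableAt ℝ (fun y => u y t) x ∧
    DifferentiableAt ℝ (fun y => θ y t) x ∧ DifferentiableAt ℝ (fun y => w y t) x ∧
    DifferentiableAt ℝ (fun y => b y t) x
  diff_xx : ∀ x : ℝ, ∀ t ∈ Icc (0:ℝ) T,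
    DifferentiableAt ℝ (fun y => pdx u y t) x ∧ DifferentiableAt ℝ (fun y => pdx θ y t) x ∧
    DifferentiableAt ℝ (fun y => pdx w y t) x ∧ DifferentiableAt ℝ (fun y => pdx b y t) x
  diff_t : ∀ x : ℝ, ∀ t ∈ Icc (0:ℝ) T,
    DifferentiableWithinAt ℝ (fun s => v x s) (Icc 0 T) t ∧
    DifferentiableWithinAt ℝ (fun s => u x s) (Icc 0 T) t ∧
    DifferentiableWithinAt ℝ (fun s => θ x s) (Icc 0 T) t ∧
    DifferentiableWithinAt ℝ (fun s => w x s) (Icc 0 T) t ∧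
    DifferentiableWithinAt ℝ (fun s => b x s) (Icc 0 T) t
  cont : ContinuousOn (fun p : ℝ × ℝ =>
      (v p.1 p.2, u p.1 p.2, θ p.1 p.2, w p.1 p.2, b p.1 p.2)) (univ ×ˢ Icc 0 T)
  cont_dx : ContinuousOn (fun p : ℝ × ℝ =>
      (pdx v p.1 p.2, pdx u p.1 p.2, pdx θ p.1 p.2, pdx w p.1 p.2, pdx b p.1 p.2))
      (univ ×ˢ Icc 0 T)
  cont_dxx : ContinuousOn (fun p : ℝ × ℝ =>
      (pdx (pdx u) p.1 p.2, pdx (pdx θ) p.1 p.2, pdx (pdx w) p.1 p.2, pdx (pdx b) p.1 p.2))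
      (univ ×ˢ Icc 0 T)
  cont_dt : ContinuousOn (fun p : ℝ × ℝ =>
      (pdt T v p.1 p.2, pdt T u p.1 p.2, pdt T θ p.1 p.2, pdt T w p.1 p.2, pdt T b p.1 p.2))
      (univ ×ˢ Icc 0 T)
  eq_mass : ∀ x : ℝ, ∀ t ∈ Icc (0:ℝ) T, pdt T v x t = pdx u x t
  eq_mom : ∀ x : ℝ, ∀ t ∈ Icc (0:ℝ) T,
    pdt T u x t + pdx (fun y s => θ y s / v y s + sq2 (b y s) / 2) x t
      = pdx (fun y s => visc α (v y s) * pdx u y s / v y s) x t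
  eq_w : ∀ x : ℝ, ∀ t ∈ Icc (0:ℝ) T,
    pdt T w x t - pdx b x t = pdx (fun y s => (v y s)⁻¹ • pdx w y s) x t
  eq_b : ∀ x : ℝ, ∀ t ∈ Icc (0:ℝ) T,
    pdt T (fun y s => v y s • b y s) x t - pdx w x t
      = pdx (fun y s => (v y s)⁻¹ • pdx b y s) x t
  eq_temp : ∀ x : ℝ, ∀ t ∈ Icc (0:ℝ) T,
    pdt T θ x t + θ x t / v x t * pdx u x t
      = pdx (fun y s => θ y s ^ β * pdx θ y s / v y s) x t
        + (visc α (v x t) * pdx u x t ^ 2 + sq2 (pdx w x t) + sq2 (pdx b x t)) / v x t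
  farfield : ∀ ε > (0:ℝ), ∃ M : ℝ, ∀ x : ℝ, ∀ t ∈ Icc (0:ℝ) T, M ≤ |x| →
    |v x t - 1| < ε ∧ |u x t| < ε ∧ |θ x t - 1| < ε ∧
    Real.sqrt (sq2 (b x t)) < ε ∧ Real.sqrt (sq2 (w x t)) < ε
  sq_int : ∀ t ∈ Icc (0:ℝ) T,
    Integrable (fun x => (v x t - 1) ^ 2) ∧ Integrable (fun x => (u x t) ^ 2) ∧
    Integrable (fun x => (θ x t - 1) ^ 2) ∧ Integrable (fun x => sq2 (b x t)) ∧
    Integrable (fun x => sq2 (w x t)) ∧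
    Integrable (fun x => (pdx v x t) ^ 2) ∧ Integrable (fun x => (pdx u x t) ^ 2) ∧
    Integrable (fun x => (pdx θ x t) ^ 2) ∧ Integrable (fun x => sq2 (pdx b x t)) ∧
    Integrable (fun x => sq2 (pdx w x t))

/-- The initial data of a solution are `(K, δ)`-admissible: the `H¹`-type norm of
`(v₀−1, u₀, θ₀−1, b₀, w₀)` is at most `K²` and `v₀ ≥ δ`, `θ₀ ≥ δ`. -/
def Admissible (K δ : ℝ) (v u θ : ℝ → ℝ → ℝ) (w b : ℝ → ℝ → ℝ × ℝ) : Prop :=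
  (∫ x : ℝ, ((v x 0 - 1) ^ 2 + (u x 0) ^ 2 + (θ x 0 - 1) ^ 2 + sq2 (b x 0) + sq2 (w x 0)
      + (pdx v x 0) ^ 2 + (pdx u x 0) ^ 2 + (pdx θ x 0) ^ 2
      + sq2 (pdx b x 0) + sq2 (pdx w x 0))) ≤ K ^ 2 ∧
  (∀ x : ℝ, δ ≤ v x 0) ∧ (∀ x : ℝ, δ ≤ θ x 0)

/-- The quartic weight `(1 - x²/R²)²`, used as a spatial cutoff on `[-R, R]`. -/
def quarticWeight (R x : ℝ) : ℝ := (1 - x ^ 2 / R ^ 2) ^ 2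

lemma continuous_quarticWeight (R : ℝ) : Continuous (quarticWeight R) := by
  unfold quarticWeight; fun_prop

lemma quarticWeight_nonneg (R x : ℝ) : 0 ≤ quarticWeight R x := sq_nonneg _

lemma one_sub_sq_div_sq_mem {R x : ℝ} (hR : 0 < R) (hx : x ∈ Icc (-R) R) :
    0 ≤ 1 - x ^ 2 / R ^ 2 ∧ 1 - x ^ 2 / R ^ 2 ≤ 1 := by
  have h1 : x ^ 2 / R ^ 2 ≤ 1 := by
    rw [div_le_one (by positivity)]
    exact sq_le_sq' hx.1 hx.2
  have h2 : 0 ≤ x ^ 2 / R ^ 2 := by positivity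
  exact ⟨by linarith, by linarith⟩

lemma quarticWeight_le_one {R x : ℝ} (hR : 0 < R) (hx : x ∈ Icc (-R) R) :
    quarticWeight R x ≤ 1 := by
  obtain ⟨h0, h1⟩ := one_sub_sq_div_sq_mem hR hx
  exact pow_le_one₀ h0 h1

lemma hasDerivAt_quarticWeight (R x : ℝ) :
    HasDerivAt (quarticWeight R) (2 * (1 - x ^ 2 / R ^ 2) * (-(2 * x) / R ^ 2)) x := by
  have h := (((hasDerivAt_pow 2 x).div_const (R ^ 2)).const_sub 1).pow 2
  refine h.congr_deriv ?_
  norm_num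
  ring

/-- Weighted flux estimate on `[-R, R]`: the divergence `G` of a flux `F` that is controlled by
the dissipation `D` and the density `η` contributes at most a small multiple of both. -/
lemma integral_quarticWeight_mul_sub_le {F G D η : ℝ → ℝ} {C R : ℝ} (hR : 0 < R) (hC : 0 ≤ C)
    (hF : ∀ x, HasDerivAt F (G x) x) (hG : Continuous G) (hD : Continuous D) (hη : Continuous η)
    (hη0 : ∀ x, 0 ≤ η x)
    (hb : ∀ x κ, 0 < κ → κ ≤ 1 → |F x| ≤ κ * D x + C / κ * η x) :
    ∫ x in -R..R, quarticWeight R x * (G x - D x)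
      ≤ -(1 - 4 / R) * (∫ x in -R..R, quarticWeight R x * D x)
        + 4 * C / R * ∫ x in -R..R, η x := by
  have hFc : Continuous F := continuous_iff_continuousAt.2 fun x => (hF x).continuousAt
  have hw := continuous_quarticWeight R
  have hw' : Continuous fun x : ℝ => 2 * (1 - x ^ 2 / R ^ 2) * (-(2 * x) / R ^ 2) := by fun_prop
  have hparts : ∫ x in -R..R, quarticWeight R x * G x
      = - ∫ x in -R..R, 2 * (1 - x ^ 2 / R ^ 2) * (-(2 * x) / R ^ 2) * F x := by
    rw [intervalIntegral.integral_mul_deriv_eq_deriv_mul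
      (fun x _ => hasDerivAt_quarticWeight R x) (fun x _ => hF x)
      (hw'.intervalIntegrable _ _) (hG.intervalIntegrable _ _)]
    have e1 : quarticWeight R R = 0 := by simp [quarticWeight, hR.ne']
    have e2 : quarticWeight R (-R) = 0 := by simp [quarticWeight, hR.ne']
    rw [e1, e2]; ring
  have hpt : ∀ x ∈ Icc (-R) R, -(2 * (1 - x ^ 2 / R ^ 2) * (-(2 * x) / R ^ 2) * F x)
      ≤ 4 / R * (quarticWeight R x * D x) + 4 * C / R * η x := by
    intro x hx
    obtain ⟨h0, h1⟩ := one_sub_sq_div_sq_mem hR hx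
    have hq : quarticWeight R x = (1 - x ^ 2 / R ^ 2) ^ 2 := rfl
    set φ := 1 - x ^ 2 / R ^ 2
    have hηx := hη0 x
    rcases h0.eq_or_lt with h | h
    · rw [hq, ← h]
      simp only [mul_zero, zero_mul, neg_zero, ne_eq, OfNat.ofNat_ne_zero, not_false_eq_true,
        zero_pow, zero_add]
      positivity
    · have hFx := hb x φ h h1
      have hxR : |x| ≤ R := abs_le.2 hx
      calc -(2 * φ * (-(2 * x) / R ^ 2) * F x)
          ≤ |-(2 * φ * (-(2 * x) / R ^ 2) * F x)| := le_abs_self _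
        _ = 4 / R ^ 2 * (φ * |F x|) * |x| := by
            rw [abs_neg, abs_mul, abs_mul, abs_div, abs_neg, abs_mul, abs_mul, abs_of_pos h,
              abs_of_pos (by positivity : (0:ℝ) < R ^ 2), abs_two]
            ring
        _ ≤ 4 / R ^ 2 * (φ * |F x|) * R := by gcongr
        _ = 4 / R * (φ * |F x|) := by field_simp
        _ ≤ 4 / R * (φ * (φ * D x + C / φ * η x)) := by gcongr
        _ = 4 / R * (quarticWeight R x * D x) + 4 * C / R * η x := by
            rw [hq]; field_simp
  have hint : - ∫ x in -R..R, 2 * (1 - x ^ 2 / R ^ 2) * (-(2 * x) / R ^ 2) * F x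
      ≤ 4 / R * (∫ x in -R..R, quarticWeight R x * D x) + 4 * C / R * ∫ x in -R..R, η x := by
    rw [← intervalIntegral.integral_neg, ← intervalIntegral.integral_const_mul,
      ← intervalIntegral.integral_const_mul, ← intervalIntegral.integral_add
        ((by fun_prop : Continuous _).intervalIntegrable _ _)
        ((by fun_prop : Continuous _).intervalIntegrable _ _)]
    exact intervalIntegral.integral_mono_on (by linarith)
      ((by fun_prop : Continuous _).intervalIntegrable _ _)
      ((by fun_prop : Continuous _).intervalIntegrable _ _) hpt
  have hsplit : ∫ x in -R..R, quarticWeight R x * (G x - D x)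
      = (∫ x in -R..R, quarticWeight R x * G x) - ∫ x in -R..R, quarticWeight R x * D x := by
    rw [← intervalIntegral.integral_sub ((by fun_prop : Continuous _).intervalIntegrable _ _)
        ((by fun_prop : Continuous _).intervalIntegrable _ _)]
    simp only [mul_sub]
  rw [hsplit, hparts]
  linarith

lemma continuous_comp_projIcc {T : ℝ} (hT : 0 ≤ T) {f : ℝ → ℝ → ℝ}
    (hf : ContinuousOn (fun p : ℝ × ℝ => f p.1 p.2) (univ ×ˢ Icc 0 T)) :
    Continuous fun p : ℝ × ℝ => f p.1 (projIcc 0 T hT p.2) :=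
  hf.comp_continuous (f := fun p : ℝ × ℝ => (p.1, (projIcc 0 T hT p.2 : ℝ))) (by fun_prop)
    fun p => ⟨mem_univ _, (projIcc 0 T hT p.2).2⟩

lemma continuousOn_integral_of_continuousOn {T : ℝ} (hT : 0 ≤ T) {f : ℝ → ℝ → ℝ}
    (hf : ContinuousOn (fun p : ℝ × ℝ => f p.1 p.2) (univ ×ˢ Icc 0 T)) (a b : ℝ) :
    ContinuousOn (fun s => ∫ x in a..b, f x s) (Icc 0 T) := by
  have h : Continuous fun s : ℝ => ∫ x in a..b, f x (projIcc 0 T hT s) :=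
    intervalIntegral.continuous_parametric_intervalIntegral_of_continuous'
      (f := fun s x : ℝ => f x (projIcc 0 T hT s))
      ((continuous_comp_projIcc hT hf).comp continuous_swap) a b
  refine h.continuousOn.congr fun s hs => ?_
  simp only [projIcc_of_mem hT hs]

lemma continuous_slice {T : ℝ} {f : ℝ → ℝ → ℝ}
    (hf : ContinuousOn (fun p : ℝ × ℝ => f p.1 p.2) (univ ×ˢ Icc 0 T)) {t : ℝ}
    (ht : t ∈ Icc 0 T) : Continuous fun x => f x t :=
  hf.comp_continuous (f := fun x : ℝ => (x, t)) (by fun_prop) fun _ => ⟨mem_univ _, ht⟩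

lemma tendsto_integral_quarticWeight {f : ℝ → ℝ} (hf : Integrable f) :
    Tendsto (fun R => ∫ x in -R..R, quarticWeight R x * f x) atTop (nhds (∫ x, f x)) := by
  have hEq : ∀ᶠ R : ℝ in atTop,
      ∫ x, (Ioc (-R) R).indicator (fun x => quarticWeight R x * f x) x
        = ∫ x in -R..R, quarticWeight R x * f x := by
    filter_upwards [eventually_gt_atTop 0] with R hR
    rw [integral_indicator measurableSet_Ioc, intervalIntegral.integral_of_le (by linarith)]
  refine Tendsto.congr' hEq ?_
  refine tendsto_integral_filter_of_dominated_convergence (fun x => ‖f x‖) ?_ ?_ hf.norm ?_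
  · refine Eventually.of_forall fun R => ?_
    exact (((continuous_quarticWeight R).aestronglyMeasurable).mul
      hf.aestronglyMeasurable).indicator measurableSet_Ioc
  · filter_upwards [eventually_gt_atTop 0] with R hR
    refine Eventually.of_forall fun x => ?_
    by_cases hx : x ∈ Ioc (-R) R
    · rw [indicator_of_mem hx, norm_mul, Real.norm_of_nonneg (quarticWeight_nonneg R x)]
      exact mul_le_of_le_one_left (norm_nonneg _) (quarticWeight_le_one hR ⟨hx.1.le, hx.2⟩)
    · rw [indicator_of_notMem hx]; simp
  · refine Eventually.of_forall fun x => ?_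
    have h1 : Tendsto (fun R : ℝ => quarticWeight R x * f x) atTop (nhds (f x)) := by
      have h2 : Tendsto (fun R : ℝ => x ^ 2 / R ^ 2) atTop (nhds 0) :=
        tendsto_const_nhds.div_atTop (tendsto_pow_atTop two_ne_zero)
      have h3 := (((h2.const_sub 1).pow 2).mul_const (f x))
      simpa [quarticWeight] using h3
    refine h1.congr' ?_
    filter_upwards [eventually_gt_atTop |x|] with R hR
    obtain ⟨h4, h5⟩ := abs_lt.1 hR
    rw [indicator_of_mem (show x ∈ Ioc (-R) R from ⟨h4, h5.le⟩)]

/-- Fundamental theorem of calculus in time, followed by an exchange of the order of integration,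
for a weighted density. -/
lemma integral_quarticWeight_evolution {T : ℝ} {η H : ℝ → ℝ → ℝ}
    (hη : ∀ x, ∀ t ∈ Icc 0 T, HasDerivWithinAt (fun s => η x s) (H x t) (Icc 0 T) t)
    (hηc : ContinuousOn (fun p : ℝ × ℝ => η p.1 p.2) (univ ×ˢ Icc 0 T))
    (hHc : ContinuousOn (fun p : ℝ × ℝ => H p.1 p.2) (univ ×ˢ Icc 0 T))
    (R : ℝ) {t : ℝ} (ht : t ∈ Icc 0 T) :
    ∫ x in -R..R, quarticWeight R x * η x t
      = (∫ x in -R..R, quarticWeight R x * η x 0)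
        + ∫ s in (0:ℝ)..t, ∫ x in -R..R, quarticWeight R x * H x s := by
  have hw := continuous_quarticWeight R
  have h0 : (0:ℝ) ∈ Icc 0 T := ⟨le_rfl, ht.1.trans ht.2⟩
  have hsub : Icc 0 t ⊆ Icc 0 T := Icc_subset_Icc_right ht.2
  have hwH : ContinuousOn (fun p : ℝ × ℝ => quarticWeight R p.1 * H p.1 p.2)
      (univ ×ˢ Icc 0 T) := (hw.comp continuous_fst).continuousOn.mul hHc
  have hftc : ∀ x, ∫ s in (0:ℝ)..t, H x s = η x t - η x 0 := by
    intro x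
    refine intervalIntegral.integral_eq_sub_of_hasDeriv_right_of_le ht.1
      (fun s hs => ((hη x s (hsub hs)).mono hsub).continuousWithinAt) (fun s hs => ?_) ?_
    · have hs' : s ∈ Ioo 0 T := ⟨hs.1, hs.2.trans_le ht.2⟩
      exact ((hη x s (Ioo_subset_Icc_self hs')).hasDerivAt
        (Icc_mem_nhds hs'.1 hs'.2)).hasDerivWithinAt
    · refine ContinuousOn.intervalIntegrable ?_
      rw [uIcc_of_le ht.1]
      exact hHc.comp (f := fun s : ℝ => (x, s)) (by fun_prop) fun s hs => ⟨mem_univ _, hsub hs⟩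
  have hswap : ∫ s in (0:ℝ)..t, ∫ x in -R..R, quarticWeight R x * H x s
      = ∫ x in -R..R, ∫ s in (0:ℝ)..t, quarticWeight R x * H x s := by
    refine (intervalIntegral_intervalIntegral_swap ?_).symm
    have hK : IntegrableOn (fun p : ℝ × ℝ => quarticWeight R p.1 * H p.1 p.2)
        (uIcc (-R) R ×ˢ Icc 0 t) :=
      (hwH.mono (prod_mono (subset_univ _) hsub)).integrableOn_compact
        (isCompact_uIcc.prod isCompact_Icc)
    refine hK.mono_set (prod_mono uIoc_subset_uIcc ?_)
    rw [uIoc_of_le ht.1]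
    exact Ioc_subset_Icc_self
  rw [hswap, ← intervalIntegral.integral_add]
  · refine intervalIntegral.integral_congr fun x _ => ?_
    simp only [intervalIntegral.integral_const_mul, hftc]
    ring
  · exact (hw.mul (continuous_slice hηc h0)).intervalIntegrable _ _
  · simp only [intervalIntegral.integral_const_mul, hftc]
    exact (hw.mul ((continuous_slice hηc ht).sub
      (continuous_slice hηc h0))).intervalIntegrable _ _

/-- Abstract energy estimate for a balance law `η_t + D = F_x` on `ℝ × [0, T]` with nonnegative
density `η` vanishing at infinity uniformly in time, nonnegative dissipation `D`, and a flux `F`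
controlled by `D` and `η`. -/
theorem energy_estimate_of_balance_law {T C : ℝ} (hT : 0 ≤ T) (hC : 0 ≤ C)
    {η D F G : ℝ → ℝ → ℝ}
    (hη : ∀ x, ∀ t ∈ Icc 0 T, HasDerivWithinAt (fun s => η x s) (G x t - D x t) (Icc 0 T) t)
    (hF : ∀ x, ∀ t ∈ Icc 0 T, HasDerivAt (fun y => F y t) (G x t) x)
    (hηc : ContinuousOn (fun p : ℝ × ℝ => η p.1 p.2) (univ ×ˢ Icc 0 T))
    (hGc : ContinuousOn (fun p : ℝ × ℝ => G p.1 p.2) (univ ×ˢ Icc 0 T))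
    (hDc : ContinuousOn (fun p : ℝ × ℝ => D p.1 p.2) (univ ×ˢ Icc 0 T))
    (hη0 : ∀ x, ∀ t ∈ Icc 0 T, 0 ≤ η x t) (hD0 : ∀ x, ∀ t ∈ Icc 0 T, 0 ≤ D x t)
    (hb : ∀ x, ∀ t ∈ Icc 0 T, ∀ κ, 0 < κ → κ ≤ 1 → |F x t| ≤ κ * D x t + C / κ * η x t)
    (hdecay : ∀ ε > 0, ∃ A, 0 ≤ A ∧ ∀ x, ∀ t ∈ Icc 0 T, η x t ≤ ε + A * (1 + x ^ 2)⁻¹)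
    (hDi : ∀ t ∈ Icc 0 T, Integrable fun x => D x t)
    (hηi : Integrable fun x => η x 0) :
    (∀ t ∈ Icc 0 T, ∫ x, η x t ≤ ∫ x, η x 0) ∧
      ∫ s in (0:ℝ)..T, ∫ x, D x s ≤ ∫ x, η x 0 := by
  have hwD : ∀ R : ℝ, ContinuousOn (fun p : ℝ × ℝ => quarticWeight R p.1 * D p.1 p.2)
      (univ ×ˢ Icc 0 T) :=
    fun R => ((continuous_quarticWeight R).comp continuous_fst).continuousOn.mul hDc
  have hdc : ∀ R : ℝ, ContinuousOn (fun s => ∫ x in -R..R, quarticWeight R x * D x s) (Icc 0 T) :=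
    fun R => continuousOn_integral_of_continuousOn (f := fun x s => quarticWeight R x * D x s)
      hT (hwD R) (-R) R
  have htrunc : ∀ R : ℝ, 0 < R → ∀ t ∈ Icc 0 T, ∀ ε A : ℝ,
      (∀ x, ∀ t ∈ Icc 0 T, η x t ≤ ε + A * (1 + x ^ 2)⁻¹) → 0 ≤ A →
      (∫ x in -R..R, quarticWeight R x * η x t)
        + (1 - 4 / R) * (∫ s in (0:ℝ)..t, ∫ x in -R..R, quarticWeight R x * D x s)
      ≤ (∫ x in -R..R, quarticWeight R x * η x 0) + t * (4 * C / R * (2 * R * ε + A * Real.pi)) := by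
    intro R hR t ht ε A hA hA0
    have hsub : Icc 0 t ⊆ Icc 0 T := Icc_subset_Icc_right ht.2
    rw [integral_quarticWeight_evolution hη hηc (hGc.sub hDc) R ht, add_assoc]
    gcongr
    have hη1 : ∀ s ∈ Icc 0 t, ∫ x in -R..R, η x s ≤ 2 * R * ε + A * Real.pi := by
      intro s hs
      have hi : Continuous fun x : ℝ => (1 + x ^ 2)⁻¹ :=
        (by fun_prop : Continuous fun x : ℝ => 1 + x ^ 2).inv₀ fun x => by positivity
      calc ∫ x in -R..R, η x s ≤ ∫ x in -R..R, (ε + A * (1 + x ^ 2)⁻¹) :=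
            intervalIntegral.integral_mono_on (by linarith)
              ((continuous_slice hηc (hsub hs)).intervalIntegrable _ _)
              ((by fun_prop : Continuous _).intervalIntegrable _ _) fun x _ => hA x s (hsub hs)
        _ = 2 * R * ε + A * (Real.arctan R - Real.arctan (-R)) := by
            rw [intervalIntegral.integral_add (by simp)
              ((by fun_prop : Continuous _).intervalIntegrable _ _),
              intervalIntegral.integral_const_mul, integral_inv_one_add_sq,
              intervalIntegral.integral_const, smul_eq_mul]
            ring
        _ ≤ 2 * R * ε + A * Real.pi := by
            have h1 := Real.arctan_lt_pi_div_two R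
            rw [Real.arctan_neg]
            gcongr
            linarith
    have hle : ∫ s in (0:ℝ)..t, ∫ x in -R..R, quarticWeight R x * (G x s - D x s)
        ≤ ∫ s in (0:ℝ)..t, (-(1 - 4 / R) * (∫ x in -R..R, quarticWeight R x * D x s)
            + 4 * C / R * (2 * R * ε + A * Real.pi)) := by
      refine intervalIntegral.integral_mono_on ht.1 ?_ ?_ fun s hs => ?_
      · refine ContinuousOn.intervalIntegrable ?_
        rw [uIcc_of_le ht.1]
        exact (continuousOn_integral_of_continuousOn hT
          (f := fun x s => quarticWeight R x * (G x s - D x s))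
          (((continuous_quarticWeight R).comp continuous_fst).continuousOn.mul (hGc.sub hDc))
          (-R) R).mono hsub
      · refine ContinuousOn.intervalIntegrable ?_
        rw [uIcc_of_le ht.1]
        exact (((hdc R).mono hsub).const_smul (-(1 - 4 / R))).add continuousOn_const
      · have hs' := hsub hs
        refine (integral_quarticWeight_mul_sub_le hR hC (fun x => hF x s hs')
          (continuous_slice hGc hs') (continuous_slice hDc hs') (continuous_slice hηc hs')
          (fun x => hη0 x s hs') fun x => hb x s hs').trans ?_
        have := hη1 s hs
        gcongr
    rw [intervalIntegral.integral_add, intervalIntegral.integral_const_mul,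
      intervalIntegral.integral_const, smul_eq_mul, sub_zero] at hle
    · linarith
    · refine ContinuousOn.intervalIntegrable ?_
      rw [uIcc_of_le ht.1]
      exact ((hdc R).mono hsub).const_smul (-(1 - 4 / R))
    · simp
  have hnn : ∀ R : ℝ, 0 < R → ∀ s ∈ Icc 0 T, 0 ≤ ∫ x in -R..R, quarticWeight R x * D x s :=
    fun R hR s hs => intervalIntegral.integral_nonneg (by linarith) fun x _ =>
      mul_nonneg (quarticWeight_nonneg R x) (hD0 x s hs)
  have hlim : ∀ t ε A : ℝ, Tendsto (fun R : ℝ => (∫ x in -R..R, quarticWeight R x * η x 0)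
      + t * (4 * C / R * (2 * R * ε + A * Real.pi))) atTop
      (nhds ((∫ x, η x 0) + t * (8 * C * ε))) := by
    intro t ε A
    refine (tendsto_integral_quarticWeight hηi).add (Tendsto.const_mul t ?_)
    have h1 : Tendsto (fun R : ℝ => 8 * C * ε + 4 * C * A * Real.pi / R) atTop
        (nhds (8 * C * ε + 0)) := tendsto_const_nhds.add (tendsto_const_nhds.div_atTop tendsto_id)
    rw [add_zero] at h1
    refine h1.congr' ?_
    filter_upwards [eventually_gt_atTop 0] with R hR
    field_simp
    ring
  have hE0 : 0 ≤ ∫ x, η x 0 := integral_nonneg fun x => hη0 x 0 ⟨le_rfl, hT⟩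
  have hclose : ∀ a : ℝ, (∀ ε > 0, a ≤ (∫ x, η x 0) + T * (8 * C * ε)) → a ≤ ∫ x, η x 0 := by
    intro a ha
    refine le_of_forall_pos_le_add fun δ hδ => ?_
    have h1 : 0 < 8 * C * T + 1 := by positivity
    refine (ha (δ / (8 * C * T + 1)) (by positivity)).trans ?_
    gcongr
    rw [← mul_assoc, ← mul_div_assoc, div_le_iff₀ h1]
    nlinarith
  refine ⟨fun t ht => ?_, ?_⟩
  · by_cases hi : Integrable fun x => η x t
    · refine hclose _ fun ε hε => ?_
      obtain ⟨A, hA0, hA⟩ := hdecay ε hε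
      have h1 : ∫ x, η x t ≤ (∫ x, η x 0) + t * (8 * C * ε) := by
        refine le_of_tendsto_of_tendsto (tendsto_integral_quarticWeight hi) (hlim t ε A) ?_
        filter_upwards [eventually_ge_atTop 4] with R hR
        have hR0 : 0 < R := by linarith
        refine le_trans ?_ (htrunc R hR0 t ht ε A hA hA0)
        have h2 : 0 ≤ 1 - 4 / R := by rw [sub_nonneg, div_le_one hR0]; exact hR
        have h3 : 0 ≤ ∫ s in (0:ℝ)..t, ∫ x in -R..R, quarticWeight R x * D x s :=
          intervalIntegral.integral_nonneg ht.1 fun s hs => hnn R hR0 s ⟨hs.1, hs.2.trans ht.2⟩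
        have := mul_nonneg h2 h3
        linarith
      refine h1.trans ?_
      gcongr
      exact ht.2
    · rw [integral_undef hi]; exact hE0
  · by_cases hi : IntervalIntegrable (fun s => ∫ x, D x s) volume 0 T
    · refine hclose _ fun ε hε => ?_
      obtain ⟨A, hA0, hA⟩ := hdecay ε hε
      have hd : Tendsto (fun R : ℝ => ∫ s in (0:ℝ)..T, ∫ x in -R..R, quarticWeight R x * D x s)
          atTop (nhds (∫ s in (0:ℝ)..T, ∫ x, D x s)) := by
        refine intervalIntegral.tendsto_integral_filter_of_dominated_convergence _ ?_ ?_ hi ?_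
        · refine Eventually.of_forall fun R => ?_
          rw [uIoc_of_le hT]
          exact ((hdc R).mono Ioc_subset_Icc_self).aestronglyMeasurable measurableSet_Ioc
        · filter_upwards [eventually_gt_atTop 0] with R hR
          refine Eventually.of_forall fun s hs => ?_
          rw [uIoc_of_le hT] at hs
          have hs' := Ioc_subset_Icc_self hs
          rw [Real.norm_of_nonneg (hnn R hR s hs')]
          have hDs := continuous_slice hDc hs'
          have hw := continuous_quarticWeight R
          calc ∫ x in -R..R, quarticWeight R x * D x s ≤ ∫ x in -R..R, D x s :=
                intervalIntegral.integral_mono_on (by linarith)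
                  ((hw.mul hDs).intervalIntegrable _ _) (hDs.intervalIntegrable _ _)
                  fun x hx => mul_le_of_le_one_left (hD0 x s hs') (quarticWeight_le_one hR hx)
            _ ≤ ∫ x, D x s := by
                rw [intervalIntegral.integral_of_le (by linarith)]
                exact setIntegral_le_integral (hDi s hs')
                  (Eventually.of_forall fun x => hD0 x s hs')
        · refine Eventually.of_forall fun s hs => ?_
          rw [uIoc_of_le hT] at hs
          exact tendsto_integral_quarticWeight (hDi s (Ioc_subset_Icc_self hs))
      have h4 : Tendsto (fun R : ℝ => 1 - 4 / R) atTop (nhds (1 - 0)) :=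
        (tendsto_const_nhds.div_atTop tendsto_id).const_sub 1
      have h5 := h4.mul hd
      rw [sub_zero, one_mul] at h5
      refine le_of_tendsto_of_tendsto h5 (hlim T ε A) ?_
      filter_upwards [eventually_gt_atTop 0] with R hR
      refine le_trans ?_ (htrunc R hR T ⟨hT, le_rfl⟩ ε A hA hA0)
      have : 0 ≤ ∫ x in -R..R, quarticWeight R x * η x T :=
        intervalIntegral.integral_nonneg (by linarith) fun x _ =>
          mul_nonneg (quarticWeight_nonneg R x) (hη0 x T ⟨hT, le_rfl⟩)
      linarith
    · rw [intervalIntegral.integral_undef hi]; exact hE0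

/-- Euclidean inner product on `ℝ × ℝ`. -/
def dot2 (p q : ℝ × ℝ) : ℝ := p.1 * q.1 + p.2 * q.2

/-- The pointwise entropy density of the MHD system. -/
def energyDensity (v u θ : ℝ) (w b : ℝ × ℝ) : ℝ :=
  (u ^ 2 + sq2 w + v * sq2 b) / 2 + (v - Real.log v - 1) + (θ - Real.log θ - 1)

/-- The chain-rule expression for the time derivative of `energyDensity`. -/
def energyDensityDeriv (v u θ : ℝ) (w b : ℝ × ℝ) (v' u' θ' : ℝ) (w' b' : ℝ × ℝ) : ℝ :=
  u * u' + dot2 w w' + v' * sq2 b / 2 + v * dot2 b b' + (1 - v⁻¹) * v' + (1 - θ⁻¹) * θ'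

/-- The pointwise entropy dissipation rate of the MHD system. -/
def dissipation (α β v θ ux θx : ℝ) (wx bx : ℝ × ℝ) : ℝ :=
  θ ^ (β - 2) * θx ^ 2 / v + (visc α v * ux ^ 2 + sq2 wx + sq2 bx) / (v * θ)

/-- The entropy flux of the MHD system. -/
def energyFlux (α β v u θ : ℝ) (w b : ℝ × ℝ) (ux θx : ℝ) (wx bx : ℝ × ℝ) : ℝ :=
  (1 - θ⁻¹) * (θ ^ β * θx / v) + u * (visc α v * ux / v) + dot2 w (v⁻¹ • wx) + dot2 b (v⁻¹ • bx)
    - u * (θ / v + sq2 b / 2) + dot2 w b + u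

lemma sq2_nonneg (p : ℝ × ℝ) : 0 ≤ sq2 p := by unfold sq2; positivity

lemma visc_nonneg {α z : ℝ} (hα : 0 ≤ α) (hz : 0 < z) : 0 ≤ visc α z := by
  unfold visc; positivity

lemma visc_le {α z K : ℝ} (hα : 0 ≤ α) (hz : 0 < z) (hK : z⁻¹ ≤ K) :
    visc α z ≤ 1 + α * K ^ α := by
  unfold visc
  rw [Real.rpow_neg hz.le, ← Real.inv_rpow hz.le]
  have := Real.rpow_le_rpow (by positivity) hK hα
  gcongr

lemma entropy_nonneg {z : ℝ} (hz : 0 < z) : 0 ≤ z - Real.log z - 1 := by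
  linarith [Real.log_le_sub_one_of_pos hz]

lemma entropy_le {z : ℝ} (hz : 0 < z) : z - Real.log z - 1 ≤ (z - 1) ^ 2 * z⁻¹ := by
  have h := Real.log_le_sub_one_of_pos (inv_pos.2 hz)
  rw [Real.log_inv] at h
  have e : (z - 1) ^ 2 * z⁻¹ = z - 2 + z⁻¹ := by field_simp; ring
  linarith

lemma sq_sub_one_le_entropy {z : ℝ} (hz : 0 < z) :
    (z - 1) ^ 2 ≤ 2 * (z + 1) * (z - Real.log z - 1) := by
  have hs := Real.sqrt_pos.2 hz
  have hsq := Real.sq_sqrt hz.le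
  have h1 : Real.log z = 2 * Real.log (Real.sqrt z) := by
    rw [Real.log_sqrt hz.le]; ring
  have h2 := Real.log_le_sub_one_of_pos hs
  have h3 : (Real.sqrt z - 1) ^ 2 ≤ z - Real.log z - 1 := by nlinarith
  calc (z - 1) ^ 2 = (Real.sqrt z + 1) ^ 2 * (Real.sqrt z - 1) ^ 2 := by rw [← hsq]; simp; ring
    _ ≤ 2 * (z + 1) * (Real.sqrt z - 1) ^ 2 := by
        gcongr
        nlinarith [sq_nonneg (Real.sqrt z - 1)]
    _ ≤ _ := by gcongr

lemma energyDensity_nonneg {v θ : ℝ} (hv : 0 < v) (hθ : 0 < θ) (u : ℝ) (w b : ℝ × ℝ) :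
    0 ≤ energyDensity v u θ w b := by
  have h1 := entropy_nonneg hv
  have h2 := entropy_nonneg hθ
  have h3 := sq2_nonneg w
  have h4 := sq2_nonneg b
  unfold energyDensity
  positivity

lemma dissipation_nonneg {α v θ : ℝ} (hα : 0 ≤ α) (hv : 0 < v) (hθ : 0 < θ) (β ux θx : ℝ)
    (wx bx : ℝ × ℝ) : 0 ≤ dissipation α β v θ ux θx wx bx := by
  have h1 := visc_nonneg hα hv
  have h3 := sq2_nonneg wx
  have h4 := sq2_nonneg bx
  unfold dissipation
  positivity

/-- The squared distance to the equilibrium `(1, 0, 1, 0, 0)` is controlled by the entropy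
density. -/
lemma sq_dist_le_energyDensity {v u θ K : ℝ} {w b : ℝ × ℝ} (hK : 1 ≤ K) (hv : 0 < v)
    (hθ : 0 < θ) (hvK : v ≤ K) (hvK' : v⁻¹ ≤ K) (hθK : θ ≤ K) :
    u ^ 2 + sq2 w + sq2 b + (v - 1) ^ 2 + (θ - 1) ^ 2 ≤ 14 * K * energyDensity v u θ w b := by
  have a1 := entropy_nonneg hv
  have a2 := entropy_nonneg hθ
  have b1 := sq_sub_one_le_entropy hv
  have b2 := sq_sub_one_le_entropy hθ
  have h3 := sq2_nonneg w
  have h4 := sq2_nonneg b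
  have c1 : (v - 1) ^ 2 ≤ 4 * K * (v - Real.log v - 1) := by
    exact b1.trans (mul_le_mul_of_nonneg_right (by linarith) a1)
  have c2 : (θ - 1) ^ 2 ≤ 4 * K * (θ - Real.log θ - 1) := by
    exact b2.trans (mul_le_mul_of_nonneg_right (by linarith) a2)
  have c3 : sq2 b ≤ K * (v * sq2 b) := by
    calc sq2 b = v⁻¹ * (v * sq2 b) := by field_simp
      _ ≤ _ := by gcongr
  have h5 : 0 ≤ v * sq2 b := by positivity
  unfold energyDensity
  have hu := sq_nonneg u
  have m1 := mul_le_mul_of_nonneg_right hK hu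
  have m2 := mul_le_mul_of_nonneg_right hK h3
  have m5 := mul_nonneg (by linarith : 0 ≤ K) h5
  have m3 := mul_nonneg (by linarith : 0 ≤ K) a1
  have m4 := mul_nonneg (by linarith : 0 ≤ K) a2
  nlinarith

lemma energyDensity_le_sq_dist {v u θ K : ℝ} {w b : ℝ × ℝ} (hK : 1 ≤ K) (hv : 0 < v)
    (hθ : 0 < θ) (hvK : v ≤ K) (hvK' : v⁻¹ ≤ K) (hθK' : θ⁻¹ ≤ K) :
    energyDensity v u θ w b ≤ K * (u ^ 2 + sq2 w + sq2 b + (v - 1) ^ 2 + (θ - 1) ^ 2) := by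
  have a1 := (entropy_le hv).trans (mul_le_mul_of_nonneg_left hvK' (sq_nonneg (v - 1)))
  have a2 := (entropy_le hθ).trans (mul_le_mul_of_nonneg_left hθK' (sq_nonneg (θ - 1)))
  have h3 := sq2_nonneg w
  have h4 := sq2_nonneg b
  have m1 := mul_le_mul_of_nonneg_right hK (sq_nonneg u)
  have m2 := mul_le_mul_of_nonneg_right hK h3
  have m3 := mul_le_mul_of_nonneg_right hvK h4
  have m4 := mul_nonneg hv.le h4
  unfold energyDensity
  nlinarith [sq_nonneg u]

lemma abs_mul_le_young {κ k θ L : ℝ} (hκ : 0 < κ) (hk : 0 ≤ k) (hθ : 0 < θ) (hL : k * θ ≤ L)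
    (x y : ℝ) : |x * (k * y)| ≤ κ * (k * y ^ 2 / θ) + L / κ * x ^ 2 := by
  have h0 : |x * y| ≤ κ * (y ^ 2 / θ) + θ / κ * x ^ 2 := by
    have e : κ * (y ^ 2 / θ) + θ / κ * x ^ 2 = ((κ * |y|) ^ 2 + (θ * |x|) ^ 2) / (κ * θ) := by
      rw [mul_pow, mul_pow, sq_abs, sq_abs]
      field_simp
    rw [e, le_div_iff₀ (by positivity), abs_mul]
    nlinarith [sq_nonneg (κ * |y| - θ * |x|), mul_nonneg (mul_nonneg hκ.le (abs_nonneg y))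
      (mul_nonneg hθ.le (abs_nonneg x))]
  calc |x * (k * y)| = k * |x * y| := by
        rw [mul_left_comm, abs_mul, abs_of_nonneg hk]
    _ ≤ k * (κ * (y ^ 2 / θ) + θ / κ * x ^ 2) := by gcongr
    _ = κ * (k * y ^ 2 / θ) + (k * θ) / κ * x ^ 2 := by ring
    _ ≤ _ := by gcongr

lemma energyFlux_eq {v θ : ℝ} (hv : 0 < v) (hθ : 0 < θ) (α β u : ℝ) (w b : ℝ × ℝ)
    (ux θx : ℝ) (wx bx : ℝ × ℝ) :
    energyFlux α β v u θ w b ux θx wx bx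
      = (θ - 1) * (θ ^ (β - 1) / v * θx) + u * (visc α v / v * ux)
        + (w.1 * (v⁻¹ * wx.1) + w.2 * (v⁻¹ * wx.2)) + (b.1 * (v⁻¹ * bx.1) + b.2 * (v⁻¹ * bx.2))
        + u * (1 - θ / v) - u * (sq2 b / 2) + dot2 w b := by
  unfold energyFlux
  simp only [dot2, Prod.smul_fst, Prod.smul_snd, smul_eq_mul]
  rw [Real.rpow_sub_one hθ.ne']
  field_simp
  ring

lemma dissipation_eq {v θ : ℝ} (hv : 0 < v) (hθ : 0 < θ) (α β ux θx : ℝ) (wx bx : ℝ × ℝ) :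
    dissipation α β v θ ux θx wx bx
      = θ ^ (β - 1) / v * θx ^ 2 / θ + visc α v / v * ux ^ 2 / θ
        + (v⁻¹ * wx.1 ^ 2 / θ + v⁻¹ * wx.2 ^ 2 / θ) + (v⁻¹ * bx.1 ^ 2 / θ + v⁻¹ * bx.2 ^ 2 / θ) := by
  unfold dissipation sq2
  rw [show β - 2 = β - 1 - 1 by ring, Real.rpow_sub_one hθ.ne' (β - 1)]
  field_simp
  ring

lemma abs_lowerOrderFlux_le {v u θ K : ℝ} {w b : ℝ × ℝ} (hK : 1 ≤ K) (hv : 0 < v)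
    (hvK' : v⁻¹ ≤ K) (huK : |u| ≤ K) :
    |u * (1 - θ / v)| + |u * (sq2 b / 2)| + |dot2 w b|
      ≤ K ^ 2 * (u ^ 2 + sq2 w + sq2 b + (v - 1) ^ 2 + (θ - 1) ^ 2) := by
  have hw0 := sq2_nonneg w
  have hb0 := sq2_nonneg b
  have hKK : K ≤ K ^ 2 := by nlinarith
  have l1 : |u * (1 - θ / v)| ≤ K ^ 2 * (u ^ 2 + (v - 1) ^ 2 + (θ - 1) ^ 2) := by
    have e : u * (1 - θ / v) = v⁻¹ * (u * ((v - 1) - (θ - 1))) := by field_simp; ring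
    rw [e, abs_mul, abs_of_pos (inv_pos.2 hv)]
    have : |u * ((v - 1) - (θ - 1))| ≤ u ^ 2 + (v - 1) ^ 2 + (θ - 1) ^ 2 := by
      rw [abs_le]
      constructor <;>
      nlinarith [sq_nonneg (u - (v - 1)), sq_nonneg (u + (v - 1)), sq_nonneg (u - (θ - 1)),
        sq_nonneg (u + (θ - 1))]
    have h2 := hvK'.trans hKK
    gcongr
  have l2 : |u * (sq2 b / 2)| ≤ K ^ 2 * (sq2 b / 2) := by
    rw [abs_mul, abs_of_nonneg (by positivity : 0 ≤ sq2 b / 2)]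
    have h2 := huK.trans hKK
    gcongr
  have l3 : |dot2 w b| ≤ K ^ 2 * (sq2 w / 2 + sq2 b / 2) := by
    have h1 : |dot2 w b| ≤ sq2 w / 2 + sq2 b / 2 := by
      unfold dot2 sq2
      rw [abs_le]
      constructor <;>
      nlinarith [sq_nonneg (w.1 - b.1), sq_nonneg (w.1 + b.1), sq_nonneg (w.2 - b.2),
        sq_nonneg (w.2 + b.2)]
    have h2 : 1 ≤ K ^ 2 := hK.trans hKK
    nlinarith
  have h3 := mul_nonneg (sq_nonneg K) hw0
  linarith

/-- The constant controlling the entropy flux when `v, θ, v⁻¹, θ⁻¹, |u|` are bounded by `K`. -/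
def fluxConst (α β K : ℝ) : ℝ :=
  K ^ β * K + (1 + α * K ^ α) * K ^ 2 + 4 * K ^ 2

lemma abs_energyFlux_le {α β v u θ K κ : ℝ} {w b : ℝ × ℝ} (hα : 0 ≤ α) (hβ : 0 < β) (hK : 1 ≤ K)
    (hv : 0 < v) (hθ : 0 < θ) (hvK : v ≤ K) (hvK' : v⁻¹ ≤ K) (hθK : θ ≤ K)
    (huK : |u| ≤ K) (hκ : 0 < κ) (hκ1 : κ ≤ 1) (ux θx : ℝ) (wx bx : ℝ × ℝ) :
    |energyFlux α β v u θ w b ux θx wx bx|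
      ≤ κ * dissipation α β v θ ux θx wx bx
        + fluxConst α β K * (14 * K) / κ * energyDensity v u θ w b := by
  have hK0 : 0 < K := by linarith
  have hvisc0 := visc_nonneg hα hv
  have hvisc := visc_le hα hv hvK'
  have y1 := abs_mul_le_young (κ := κ) (k := θ ^ (β - 1) / v) (θ := θ) (L := K ^ β * K) hκ
    (by positivity) hθ (by
      have h1 := Real.rpow_le_rpow hθ.le hθK hβ.le
      calc θ ^ (β - 1) / v * θ = θ ^ β * v⁻¹ := by
            rw [Real.rpow_sub_one hθ.ne']; field_simp
        _ ≤ _ := by gcongr) (θ - 1) θx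
  have y2 := abs_mul_le_young (κ := κ) (k := visc α v / v) (θ := θ)
    (L := (1 + α * K ^ α) * K ^ 2) hκ (by positivity) hθ (by
      calc visc α v / v * θ = visc α v * (v⁻¹ * θ) := by ring
        _ ≤ (1 + α * K ^ α) * (K * K) := by gcongr
        _ = _ := by ring) u ux
  have y3 : ∀ x y : ℝ, |x * (v⁻¹ * y)| ≤ κ * (v⁻¹ * y ^ 2 / θ) + K ^ 2 / κ * x ^ 2 :=
    abs_mul_le_young hκ (by positivity) hθ (by
      calc v⁻¹ * θ ≤ K * K := by gcongr
        _ = _ := by ring)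
  have hS := sq_dist_le_energyDensity (u := u) (w := w) (b := b) hK hv hθ hvK hvK' hθK
  set S := u ^ 2 + sq2 w + sq2 b + (v - 1) ^ 2 + (θ - 1) ^ 2 with hSdef
  have hw0 := sq2_nonneg w
  have hb0 := sq2_nonneg b
  have hu0 := sq_nonneg u
  have hv0 := sq_nonneg (v - 1)
  have hθ0 := sq_nonneg (θ - 1)
  have htri : |energyFlux α β v u θ w b ux θx wx bx|
      ≤ |(θ - 1) * (θ ^ (β - 1) / v * θx)| + |u * (visc α v / v * ux)|
        + (|w.1 * (v⁻¹ * wx.1)| + |w.2 * (v⁻¹ * wx.2)|)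
        + (|b.1 * (v⁻¹ * bx.1)| + |b.2 * (v⁻¹ * bx.2)|)
        + |u * (1 - θ / v)| + |u * (sq2 b / 2)| + |dot2 w b| := by
    rw [energyFlux_eq hv hθ]
    refine (abs_add_le _ _).trans (add_le_add_left ((abs_sub _ _).trans (add_le_add_left
      ((abs_add_le _ _).trans (add_le_add_left ((abs_add_le _ _).trans (add_le_add
      ((abs_add_le _ _).trans (add_le_add (abs_add_le _ _) (abs_add_le _ _)))
      (abs_add_le _ _))) _)) _)) _)
  have hlow := (abs_lowerOrderFlux_le (w := w) (b := b) (θ := θ) hK hv hvK' huK).trans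
    (mul_le_mul_of_nonneg_right (a := S) (le_div_self (sq_nonneg K) hκ hκ1) (by positivity))
  have hA : K ^ β * K / κ * (θ - 1) ^ 2 ≤ K ^ β * K / κ * S := by gcongr; linarith
  have hB : (1 + α * K ^ α) * K ^ 2 / κ * u ^ 2 ≤ (1 + α * K ^ α) * K ^ 2 / κ * S := by
    gcongr; linarith
  have hCw : K ^ 2 / κ * sq2 w ≤ K ^ 2 / κ * S := by gcongr; linarith
  have hCb : K ^ 2 / κ * sq2 b ≤ K ^ 2 / κ * S := by gcongr; linarith
  have hsum : |energyFlux α β v u θ w b ux θx wx bx|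
      ≤ κ * dissipation α β v θ ux θx wx bx + fluxConst α β K / κ * S := by
    have e : fluxConst α β K / κ * S = K ^ β * K / κ * S + (1 + α * K ^ α) * K ^ 2 / κ * S
        + 4 * (K ^ 2 / κ * S) := by unfold fluxConst; ring
    have ew : K ^ 2 / κ * sq2 w = K ^ 2 / κ * w.1 ^ 2 + K ^ 2 / κ * w.2 ^ 2 := by
      unfold sq2; ring
    have eb : K ^ 2 / κ * sq2 b = K ^ 2 / κ * b.1 ^ 2 + K ^ 2 / κ * b.2 ^ 2 := by
      unfold sq2; ring
    have hKS : 0 ≤ K ^ 2 / κ * S := by positivity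
    have z1 := y3 w.1 wx.1
    have z2 := y3 w.2 wx.2
    have z3 := y3 b.1 bx.1
    have z4 := y3 b.2 bx.2
    rw [dissipation_eq hv hθ, e]
    linarith
  refine hsum.trans ?_
  have hc : 0 ≤ fluxConst α β K := by unfold fluxConst; positivity
  calc κ * dissipation α β v θ ux θx wx bx + fluxConst α β K / κ * S
      ≤ κ * dissipation α β v θ ux θx wx bx
        + fluxConst α β K / κ * (14 * K * energyDensity v u θ w b) := by gcongr
    _ = _ := by ring

lemma dissipation_le {α β v θ K : ℝ} (hα : 0 ≤ α) (hβ : 0 < β)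
    (hv : 0 < v) (hθ : 0 < θ) (hvK' : v⁻¹ ≤ K) (hθK : θ ≤ K) (hθK' : θ⁻¹ ≤ K)
    (ux θx : ℝ) (wx bx : ℝ × ℝ) :
    dissipation α β v θ ux θx wx bx
      ≤ (K ^ β * K ^ 2) * K * θx ^ 2
        + ((1 + α * K ^ α) * ux ^ 2 + sq2 wx + sq2 bx) * (K * K) := by
  have hK0 : 0 < K := hθ.trans_le hθK
  have h1 := Real.rpow_le_rpow hθ.le hθK hβ.le
  have hw0 := sq2_nonneg wx
  have hb0 := sq2_nonneg bx
  have hvisc0 := visc_nonneg hα hv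
  have hvisc := visc_le hα hv hvK'
  have e : dissipation α β v θ ux θx wx bx = (θ ^ β * θ⁻¹ ^ 2) * v⁻¹ * θx ^ 2
      + (visc α v * ux ^ 2 + sq2 wx + sq2 bx) * (v⁻¹ * θ⁻¹) := by
    unfold dissipation
    rw [show β - 2 = β - (2 : ℕ) by norm_num, Real.rpow_sub_natCast hθ.ne']
    field_simp
  rw [e]
  gcongr

section Calculus

variable {s : Set ℝ} {x : ℝ}

lemma HasDerivWithinAt.comp_prodFst {f : ℝ → ℝ × ℝ} {f' : ℝ × ℝ} (hf : HasDerivWithinAt f f' s x) :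
    HasDerivWithinAt (fun y => (f y).1) f'.1 s x :=
  (ContinuousLinearMap.fst ℝ ℝ ℝ).hasFDerivAt.comp_hasDerivWithinAt x hf

lemma HasDerivWithinAt.comp_prodSnd {f : ℝ → ℝ × ℝ} {f' : ℝ × ℝ} (hf : HasDerivWithinAt f f' s x) :
    HasDerivWithinAt (fun y => (f y).2) f'.2 s x :=
  (ContinuousLinearMap.snd ℝ ℝ ℝ).hasFDerivAt.comp_hasDerivWithinAt x hf

lemma HasDerivWithinAt.fun_dot2 {f g : ℝ → ℝ × ℝ} {f' g' : ℝ × ℝ} (hf : HasDerivWithinAt f f' s x)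
    (hg : HasDerivWithinAt g g' s x) :
    HasDerivWithinAt (fun y => dot2 (f y) (g y)) (dot2 f' (g x) + dot2 (f x) g') s x := by
  refine ((hf.comp_prodFst.mul hg.comp_prodFst).add
    (hf.comp_prodSnd.mul hg.comp_prodSnd)).congr_deriv ?_
  simp only [dot2]
  ring

lemma HasDerivAt.fun_dot2 {f g : ℝ → ℝ × ℝ} {f' g' : ℝ × ℝ} (hf : HasDerivAt f f' x)
    (hg : HasDerivAt g g' x) :
    HasDerivAt (fun y => dot2 (f y) (g y)) (dot2 f' (g x) + dot2 (f x) g') x :=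
  hasDerivWithinAt_univ.1 (hf.hasDerivWithinAt.fun_dot2 hg.hasDerivWithinAt)

lemma HasDerivWithinAt.fun_sq2 {f : ℝ → ℝ × ℝ} {f' : ℝ × ℝ} (hf : HasDerivWithinAt f f' s x) :
    HasDerivWithinAt (fun y => sq2 (f y)) (2 * dot2 (f x) f') s x := by
  have h := hf.fun_dot2 hf
  have e : (fun y => sq2 (f y)) = fun y => dot2 (f y) (f y) := by
    funext y; simp only [sq2, dot2]; ring
  rw [e]
  refine h.congr_deriv ?_
  simp only [dot2]
  ring

lemma hasDerivWithinAt_energyDensity {v u θ : ℝ → ℝ} {w b : ℝ → ℝ × ℝ} {v' u' θ' : ℝ}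
    {w' b' : ℝ × ℝ} (hv : HasDerivWithinAt v v' s x) (hu : HasDerivWithinAt u u' s x)
    (hθ : HasDerivWithinAt θ θ' s x) (hw : HasDerivWithinAt w w' s x)
    (hb : HasDerivWithinAt b b' s x) (hv0 : v x ≠ 0) (hθ0 : θ x ≠ 0) :
    HasDerivWithinAt (fun y => energyDensity (v y) (u y) (θ y) (w y) (b y))
      (energyDensityDeriv (v x) (u x) (θ x) (w x) (b x) v' u' θ' w' b') s x := by
  refine ((((((hu.pow 2).add hw.fun_sq2).add (hv.mul hb.fun_sq2)).div_const 2).add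
    ((hv.sub (hv.log hv0)).sub_const 1)).add ((hθ.sub (hθ.log hθ0)).sub_const 1)).congr_deriv ?_
  simp only [energyDensityDeriv]
  norm_num
  ring

end Calculus

namespace IsClassicalSolution

variable {α β T : ℝ} {v u θ : ℝ → ℝ → ℝ} {w b : ℝ → ℝ → ℝ × ℝ}

lemma hasDerivWithinAt_energyDensity (h : IsClassicalSolution α β T v u θ w b) (x : ℝ) {t : ℝ}
    (ht : t ∈ Icc 0 T) :
    HasDerivWithinAt (fun s => energyDensity (v x s) (u x s) (θ x s) (w x s) (b x s))
      (energyDensityDeriv (v x t) (u x t) (θ x t) (w x t) (b x t) (pdt T v x t) (pdt T u x t)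
        (pdt T θ x t) (pdt T w x t) (pdt T b x t)) (Icc 0 T) t := by
  obtain ⟨h1, h2, h3, h4, h5⟩ := h.diff_t x t ht
  exact _root_.hasDerivWithinAt_energyDensity h1.hasDerivWithinAt h2.hasDerivWithinAt
    h3.hasDerivWithinAt h4.hasDerivWithinAt h5.hasDerivWithinAt (h.v_pos x t ht).ne'
    (h.θ_pos x t ht).ne'

/-- Pointwise entropy balance: the space derivative of the entropy flux is the time derivative of
the entropy density plus the dissipation. -/
lemma hasDerivAt_energyFlux (h : IsClassicalSolution α β T v u θ w b) (hT : 0 < T) (x : ℝ) {t : ℝ}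
    (ht : t ∈ Icc 0 T) :
    HasDerivAt (fun y => energyFlux α β (v y t) (u y t) (θ y t) (w y t) (b y t)
        (pdx u y t) (pdx θ y t) (pdx w y t) (pdx b y t))
      (energyDensityDeriv (v x t) (u x t) (θ x t) (w x t) (b x t) (pdt T v x t) (pdt T u x t)
        (pdt T θ x t) (pdt T w x t) (pdt T b x t)
        + dissipation α β (v x t) (θ x t) (pdx u x t) (pdx θ x t) (pdx w x t) (pdx b x t)) x := by
  obtain ⟨dv, du, dθ, dw, db⟩ := h.diff_x x t ht
  obtain ⟨dux, dθx, dwx, dbx⟩ := h.diff_xx x t ht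
  have hv0 := h.v_pos x t ht
  have hθ0 := h.θ_pos x t ht
  have hu : HasDerivAt (fun y => u y t) (pdx u x t) x := du.hasDerivAt
  have hθ : HasDerivAt (fun y => θ y t) (pdx θ x t) x := dθ.hasDerivAt
  have hw : HasDerivAt (fun y => w y t) (pdx w x t) x := dw.hasDerivAt
  have hb : HasDerivAt (fun y => b y t) (pdx b x t) x := db.hasDerivAt
  have hQ : HasDerivAt (fun y => θ y t ^ β * pdx θ y t / v y t)
      (pdx (fun y s => θ y s ^ β * pdx θ y s / v y s) x t) x :=
    (((dθ.rpow_const (Or.inl hθ0.ne')).mul dθx).div dv hv0.ne').hasDerivAt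
  have hS : HasDerivAt (fun y => visc α (v y t) * pdx u y t / v y t)
      (pdx (fun y s => visc α (v y s) * pdx u y s / v y s) x t) x := by
    refine DifferentiableAt.hasDerivAt (DifferentiableAt.div (DifferentiableAt.mul ?_ dux) dv
      hv0.ne')
    exact ((dv.rpow_const (p := -α) (Or.inl hv0.ne')).const_mul α).const_add 1
  have hP : HasDerivAt (fun y => θ y t / v y t + sq2 (b y t) / 2)
      (pdx (fun y s => θ y s / v y s + sq2 (b y s) / 2) x t) x := by
    refine DifferentiableAt.hasDerivAt (DifferentiableAt.add (dθ.div dv hv0.ne') ?_)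
    exact ((hasDerivWithinAt_univ.1 hb.hasDerivWithinAt.fun_sq2).div_const 2).differentiableAt
  have hW : HasDerivAt (fun y => (v y t)⁻¹ • pdx w y t)
      (pdx (fun y s => (v y s)⁻¹ • pdx w y s) x t) x :=
    ((dv.inv hv0.ne').smul dwx).hasDerivAt
  have hB : HasDerivAt (fun y => (v y t)⁻¹ • pdx b y t)
      (pdx (fun y s => (v y s)⁻¹ • pdx b y s) x t) x :=
    ((dv.inv hv0.ne').smul dbx).hasDerivAt
  have hvb : pdt T (fun y s => v y s • b y s) x t
      = v x t • pdt T b x t + pdt T v x t • b x t := by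
    obtain ⟨h1, -, -, -, h5⟩ := h.diff_t x t ht
    exact (h1.hasDerivWithinAt.smul h5.hasDerivWithinAt).derivWithin (uniqueDiffOn_Icc hT t ht)
  have e1 := h.eq_mass x t ht
  have e2 := h.eq_mom x t ht
  have e3 := h.eq_w x t ht
  have e4 := h.eq_b x t ht
  have e5 := h.eq_temp x t ht
  rw [hvb] at e4
  have hmain := ((((((((hθ.inv hθ0.ne').const_sub 1).mul hQ).add (hu.mul hS)).add
    (hw.fun_dot2 hW)).add (hb.fun_dot2 hB)).sub (hu.mul hP)).add (hw.fun_dot2 hb)).add hu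
  refine hmain.congr_deriv ?_
  have hr : θ x t ^ (β - 2) = θ x t ^ β / θ x t ^ 2 := by
    rw [show β - 2 = β - (2 : ℕ) by norm_num, Real.rpow_sub_natCast hθ0.ne']
  rw [← e2, ← e3, ← e4, eq_sub_of_add_eq e5.symm, e1]
  unfold energyDensityDeriv dissipation
  rw [hr]
  generalize pdx (fun y s => θ y s / v y s + sq2 (b y s) / 2) x t = px
  generalize θ x t ^ β = r
  simp only [dot2, sq2, Prod.smul_fst, Prod.smul_snd,
    smul_eq_mul, Prod.fst_sub, Prod.snd_sub, Prod.fst_add, Prod.snd_add, Pi.inv_apply]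
  field_simp
  ring

end IsClassicalSolution

namespace IsClassicalSolution

variable {α β T : ℝ} {v u θ : ℝ → ℝ → ℝ} {w b : ℝ → ℝ → ℝ × ℝ}

/-- The unknowns `v, v⁻¹, θ, θ⁻¹, |u|` are uniformly bounded on `ℝ × [0, T]`. -/
lemma exists_bound (h : IsClassicalSolution α β T v u θ w b) :
    ∃ K, 1 ≤ K ∧ ∀ x, ∀ t ∈ Icc 0 T,
      v x t ≤ K ∧ (v x t)⁻¹ ≤ K ∧ θ x t ≤ K ∧ (θ x t)⁻¹ ≤ K ∧ |u x t| ≤ K := by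
  obtain ⟨M, hM⟩ := h.farfield (1 / 2) (by norm_num)
  have hv : ContinuousOn (fun p : ℝ × ℝ => v p.1 p.2) (univ ×ˢ Icc 0 T) := h.cont.fst
  have hu : ContinuousOn (fun p : ℝ × ℝ => u p.1 p.2) (univ ×ˢ Icc 0 T) := h.cont.snd.fst
  have hθ : ContinuousOn (fun p : ℝ × ℝ => θ p.1 p.2) (univ ×ˢ Icc 0 T) := h.cont.snd.snd.fst
  have hg : ContinuousOn (fun p : ℝ × ℝ => v p.1 p.2 + (v p.1 p.2)⁻¹ + θ p.1 p.2
      + (θ p.1 p.2)⁻¹ + |u p.1 p.2|) (univ ×ˢ Icc 0 T) :=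
    (((hv.add (hv.inv₀ fun p hp => (h.v_pos p.1 p.2 hp.2).ne')).add hθ).add
      (hθ.inv₀ fun p hp => (h.θ_pos p.1 p.2 hp.2).ne')).add hu.abs
  obtain ⟨B, hB⟩ := ((isCompact_Icc (a := -M) (b := M)).prod
    (isCompact_Icc (a := (0:ℝ)) (b := T))).bddAbove_image
    (hg.mono (prod_mono (subset_univ _) subset_rfl))
  refine ⟨max 2 B, le_max_of_le_left (by norm_num), fun x t ht => ?_⟩
  have hv0 := h.v_pos x t ht
  have hθ0 := h.θ_pos x t ht
  rcases le_total M |x| with hx | hx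
  · obtain ⟨h1, h2, h3, -, -⟩ := hM x t ht hx
    rw [abs_lt] at h1 h3
    refine ⟨le_max_of_le_left (by linarith), le_max_of_le_left ?_, le_max_of_le_left (by linarith),
      le_max_of_le_left ?_, le_max_of_le_left (by linarith)⟩
    · rw [inv_le_comm₀ hv0 two_pos]; linarith
    · rw [inv_le_comm₀ hθ0 two_pos]; linarith
  · have hle : v x t + (v x t)⁻¹ + θ x t + (θ x t)⁻¹ + |u x t| ≤ B :=
      hB ⟨(x, t), ⟨abs_le.1 hx, ht⟩, rfl⟩
    have i1 := inv_pos.2 hv0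
    have i2 := inv_pos.2 hθ0
    have i3 := abs_nonneg (u x t)
    refine ⟨?_, ?_, ?_, ?_, ?_⟩ <;> exact le_max_of_le_right (by linarith)

lemma continuousOn_energyDensity (h : IsClassicalSolution α β T v u θ w b) :
    ContinuousOn (fun p : ℝ × ℝ => energyDensity (v p.1 p.2) (u p.1 p.2) (θ p.1 p.2)
      (w p.1 p.2) (b p.1 p.2)) (univ ×ˢ Icc 0 T) := by
  have hv : ContinuousOn (fun p : ℝ × ℝ => v p.1 p.2) (univ ×ˢ Icc 0 T) := h.cont.fst
  have hu : ContinuousOn (fun p : ℝ × ℝ => u p.1 p.2) (univ ×ˢ Icc 0 T) := h.cont.snd.fst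
  have hθ : ContinuousOn (fun p : ℝ × ℝ => θ p.1 p.2) (univ ×ˢ Icc 0 T) := h.cont.snd.snd.fst
  have hw : ContinuousOn (fun p : ℝ × ℝ => w p.1 p.2) (univ ×ˢ Icc 0 T) := h.cont.snd.snd.snd.fst
  have hb : ContinuousOn (fun p : ℝ × ℝ => b p.1 p.2) (univ ×ˢ Icc 0 T) := h.cont.snd.snd.snd.snd
  have hlv := hv.log fun p hp => (h.v_pos p.1 p.2 hp.2).ne'
  have hlθ := hθ.log fun p hp => (h.θ_pos p.1 p.2 hp.2).ne'
  unfold energyDensity sq2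
  fun_prop

lemma continuousOn_energyDensityDeriv (h : IsClassicalSolution α β T v u θ w b) :
    ContinuousOn (fun p : ℝ × ℝ => energyDensityDeriv (v p.1 p.2) (u p.1 p.2) (θ p.1 p.2)
      (w p.1 p.2) (b p.1 p.2) (pdt T v p.1 p.2) (pdt T u p.1 p.2) (pdt T θ p.1 p.2)
      (pdt T w p.1 p.2) (pdt T b p.1 p.2)) (univ ×ˢ Icc 0 T) := by
  have hv : ContinuousOn (fun p : ℝ × ℝ => v p.1 p.2) (univ ×ˢ Icc 0 T) := h.cont.fst
  have hu : ContinuousOn (fun p : ℝ × ℝ => u p.1 p.2) (univ ×ˢ Icc 0 T) := h.cont.snd.fst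
  have hθ : ContinuousOn (fun p : ℝ × ℝ => θ p.1 p.2) (univ ×ˢ Icc 0 T) := h.cont.snd.snd.fst
  have hw : ContinuousOn (fun p : ℝ × ℝ => w p.1 p.2) (univ ×ˢ Icc 0 T) := h.cont.snd.snd.snd.fst
  have hb : ContinuousOn (fun p : ℝ × ℝ => b p.1 p.2) (univ ×ˢ Icc 0 T) := h.cont.snd.snd.snd.snd
  have hv' : ContinuousOn (fun p : ℝ × ℝ => pdt T v p.1 p.2) (univ ×ˢ Icc 0 T) := h.cont_dt.fst
  have hu' : ContinuousOn (fun p : ℝ × ℝ => pdt T u p.1 p.2) (univ ×ˢ Icc 0 T) :=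
    h.cont_dt.snd.fst
  have hθ' : ContinuousOn (fun p : ℝ × ℝ => pdt T θ p.1 p.2) (univ ×ˢ Icc 0 T) :=
    h.cont_dt.snd.snd.fst
  have hw' : ContinuousOn (fun p : ℝ × ℝ => pdt T w p.1 p.2) (univ ×ˢ Icc 0 T) :=
    h.cont_dt.snd.snd.snd.fst
  have hb' : ContinuousOn (fun p : ℝ × ℝ => pdt T b p.1 p.2) (univ ×ˢ Icc 0 T) :=
    h.cont_dt.snd.snd.snd.snd
  have hv0 : ∀ p ∈ (univ : Set ℝ) ×ˢ Icc 0 T, v p.1 p.2 ≠ 0 :=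
    fun p hp => (h.v_pos p.1 p.2 hp.2).ne'
  have hθ0 : ∀ p ∈ (univ : Set ℝ) ×ˢ Icc 0 T, θ p.1 p.2 ≠ 0 :=
    fun p hp => (h.θ_pos p.1 p.2 hp.2).ne'
  unfold energyDensityDeriv sq2 dot2
  fun_prop (disch := first | assumption | norm_num)

lemma continuousOn_dissipation (h : IsClassicalSolution α β T v u θ w b) :
    ContinuousOn (fun p : ℝ × ℝ => dissipation α β (v p.1 p.2) (θ p.1 p.2) (pdx u p.1 p.2)
      (pdx θ p.1 p.2) (pdx w p.1 p.2) (pdx b p.1 p.2)) (univ ×ˢ Icc 0 T) := by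
  have hv : ContinuousOn (fun p : ℝ × ℝ => v p.1 p.2) (univ ×ˢ Icc 0 T) := h.cont.fst
  have hθ : ContinuousOn (fun p : ℝ × ℝ => θ p.1 p.2) (univ ×ˢ Icc 0 T) := h.cont.snd.snd.fst
  have hux : ContinuousOn (fun p : ℝ × ℝ => pdx u p.1 p.2) (univ ×ˢ Icc 0 T) := h.cont_dx.snd.fst
  have hθx : ContinuousOn (fun p : ℝ × ℝ => pdx θ p.1 p.2) (univ ×ˢ Icc 0 T) :=
    h.cont_dx.snd.snd.fst
  have hwx : ContinuousOn (fun p : ℝ × ℝ => pdx w p.1 p.2) (univ ×ˢ Icc 0 T) :=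
    h.cont_dx.snd.snd.snd.fst
  have hbx : ContinuousOn (fun p : ℝ × ℝ => pdx b p.1 p.2) (univ ×ˢ Icc 0 T) :=
    h.cont_dx.snd.snd.snd.snd
  have hv0 : ∀ p ∈ (univ : Set ℝ) ×ˢ Icc 0 T, v p.1 p.2 ≠ 0 :=
    fun p hp => (h.v_pos p.1 p.2 hp.2).ne'
  have hvθ0 : ∀ p ∈ (univ : Set ℝ) ×ˢ Icc 0 T, v p.1 p.2 * θ p.1 p.2 ≠ 0 :=
    fun p hp => (mul_pos (h.v_pos p.1 p.2 hp.2) (h.θ_pos p.1 p.2 hp.2)).ne'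
  have hrv : ContinuousOn (fun p : ℝ × ℝ => v p.1 p.2 ^ (-α)) (univ ×ˢ Icc 0 T) :=
    hv.rpow_const fun p hp => Or.inl (h.v_pos p.1 p.2 hp.2).ne'
  have hrθ : ContinuousOn (fun p : ℝ × ℝ => θ p.1 p.2 ^ (β - 2)) (univ ×ˢ Icc 0 T) :=
    hθ.rpow_const fun p hp => Or.inl (h.θ_pos p.1 p.2 hp.2).ne'
  unfold dissipation visc sq2
  fun_prop (disch := first | assumption | norm_num)

/-- The entropy density vanishes at spatial infinity, uniformly in time. -/
lemma energyDensity_decay (h : IsClassicalSolution α β T v u θ w b) {ε : ℝ} (hε : 0 < ε) :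
    ∃ A, 0 ≤ A ∧ ∀ x, ∀ t ∈ Icc 0 T,
      energyDensity (v x t) (u x t) (θ x t) (w x t) (b x t) ≤ ε + A * (1 + x ^ 2)⁻¹ := by
  obtain ⟨K, hK, hbd⟩ := h.exists_bound
  have hδ : 0 < Real.sqrt (ε / (5 * K)) := Real.sqrt_pos.2 (by positivity)
  have hδ2 : Real.sqrt (ε / (5 * K)) ^ 2 = ε / (5 * K) := Real.sq_sqrt (by positivity)
  obtain ⟨M, hM⟩ := h.farfield _ hδ
  obtain ⟨B, hB⟩ := ((isCompact_Icc (a := -M) (b := M)).prod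
    (isCompact_Icc (a := (0:ℝ)) (b := T))).bddAbove_image
    (h.continuousOn_energyDensity.mono (prod_mono (subset_univ _) subset_rfl))
  refine ⟨|B| * (1 + M ^ 2), by positivity, fun x t ht => ?_⟩
  rcases le_total M |x| with hx | hx
  · obtain ⟨h1, h2, h3, h4, h5⟩ := hM x t ht hx
    obtain ⟨k1, k2, k3, k4, k5⟩ := hbd x t ht
    have hle := energyDensity_le_sq_dist (u := u x t) (w := w x t) (b := b x t) hK
      (h.v_pos x t ht) (h.θ_pos x t ht) k1 k2 k4
    have s1 : (v x t - 1) ^ 2 ≤ ε / (5 * K) := by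
      rw [← hδ2, sq_le_sq, abs_of_pos hδ]; exact h1.le
    have s2 : u x t ^ 2 ≤ ε / (5 * K) := by
      rw [← hδ2, sq_le_sq, abs_of_pos hδ]; exact h2.le
    have s3 : (θ x t - 1) ^ 2 ≤ ε / (5 * K) := by
      rw [← hδ2, sq_le_sq, abs_of_pos hδ]; exact h3.le
    have s4 : sq2 (b x t) ≤ ε / (5 * K) := ((Real.sqrt_lt_sqrt_iff (sq2_nonneg _)).1 h4).le
    have s5 : sq2 (w x t) ≤ ε / (5 * K) := ((Real.sqrt_lt_sqrt_iff (sq2_nonneg _)).1 h5).le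
    calc _ ≤ _ := hle
      _ ≤ K * (ε / (5 * K) + ε / (5 * K) + ε / (5 * K) + ε / (5 * K) + ε / (5 * K)) := by gcongr
      _ = ε + 0 := by field_simp; ring
      _ ≤ _ := by gcongr; positivity
  · have hle : energyDensity (v x t) (u x t) (θ x t) (w x t) (b x t) ≤ B :=
      hB ⟨(x, t), ⟨abs_le.1 hx, ht⟩, rfl⟩
    have hxM : x ^ 2 ≤ M ^ 2 := sq_le_sq' (abs_le.1 hx).1 (abs_le.1 hx).2
    calc _ ≤ |B| * 1 := by rw [mul_one]; exact hle.trans (le_abs_self B)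
      _ ≤ |B| * ((1 + M ^ 2) * (1 + x ^ 2)⁻¹) := by
          gcongr
          rw [← div_eq_mul_inv, one_le_div (by positivity)]
          linarith
      _ ≤ _ := by rw [← mul_assoc]; linarith

lemma integrable_dissipation (h : IsClassicalSolution α β T v u θ w b) (hα : 0 ≤ α) (hβ : 0 < β)
    {t : ℝ} (ht : t ∈ Icc 0 T) :
    Integrable fun x => dissipation α β (v x t) (θ x t) (pdx u x t) (pdx θ x t) (pdx w x t)
      (pdx b x t) := by
  obtain ⟨K, hK, hbd⟩ := h.exists_bound
  obtain ⟨-, -, -, -, -, -, iu, iθ, ib, iw⟩ := h.sq_int t ht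
  have hc := continuous_slice (f := fun x t => dissipation α β (v x t) (θ x t) (pdx u x t)
    (pdx θ x t) (pdx w x t) (pdx b x t)) h.continuousOn_dissipation ht
  refine Integrable.mono' ((iθ.const_mul (K ^ β * K ^ 2 * K)).add
    ((((iu.const_mul (1 + α * K ^ α)).add iw).add ib).mul_const (K * K)))
    hc.aestronglyMeasurable (Eventually.of_forall fun x => ?_)
  obtain ⟨k1, k2, k3, k4, k5⟩ := hbd x t ht
  have hv0 := h.v_pos x t ht
  have hθ0 := h.θ_pos x t ht
  rw [Real.norm_of_nonneg (dissipation_nonneg hα hv0 hθ0 _ _ _ _ _)]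
  exact dissipation_le hα hβ hv0 hθ0 k2 k3 k4 _ _ _ _

end IsClassicalSolution

/-- the basic energy inequality (2.11) of the paper. -/
theorem energy_inequality (α β T : ℝ) (hα : 0 ≤ α) (hβ : 0 < β) (hT : 0 < T)
    (v u θ : ℝ → ℝ → ℝ) (w b : ℝ → ℝ → ℝ × ℝ)
    (hsol : IsClassicalSolution α β T v u θ w b)
    (e₀ : ℝ)
    (hfin : Integrable (fun x : ℝ =>
      ((u x 0) ^ 2 + sq2 (w x 0) + v x 0 * sq2 (b x 0)) / 2
        + (v x 0 - Real.log (v x 0) - 1) + (θ x 0 - Real.log (θ x 0) - 1)))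
    (he₀ : e₀ = 2 * ∫ x : ℝ, (((u x 0) ^ 2 + sq2 (w x 0) + v x 0 * sq2 (b x 0)) / 2
        + (v x 0 - Real.log (v x 0) - 1) + (θ x 0 - Real.log (θ x 0) - 1))) :
    ∀ t ∈ Icc (0:ℝ) T,
      (∫ x : ℝ, (((u x t) ^ 2 + sq2 (w x t) + v x t * sq2 (b x t)) / 2
          + (v x t - Real.log (v x t) - 1) + (θ x t - Real.log (θ x t) - 1)))
        + (∫ s in (0:ℝ)..T, ∫ x : ℝ,
            (θ x s ^ (β - 2) * (pdx θ x s) ^ 2 / v x s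
              + (visc α (v x s) * (pdx u x s) ^ 2 + sq2 (pdx w x s) + sq2 (pdx b x s))
                  / (v x s * θ x s)))
        ≤ e₀ := by
  have hbalance : ∀ x, ∀ t ∈ Icc 0 T, HasDerivWithinAt
      (fun s => energyDensity (v x s) (u x s) (θ x s) (w x s) (b x s))
      ((energyDensityDeriv (v x t) (u x t) (θ x t) (w x t) (b x t) (pdt T v x t) (pdt T u x t)
        (pdt T θ x t) (pdt T w x t) (pdt T b x t)
        + dissipation α β (v x t) (θ x t) (pdx u x t) (pdx θ x t) (pdx w x t) (pdx b x t))
        - dissipation α β (v x t) (θ x t) (pdx u x t) (pdx θ x t) (pdx w x t) (pdx b x t))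
      (Icc 0 T) t := fun x t ht => by
    rw [add_sub_cancel_right]
    exact hsol.hasDerivWithinAt_energyDensity x ht
  obtain ⟨K, hK, hbd⟩ := hsol.exists_bound
  have hconst : 0 ≤ fluxConst α β K * (14 * K) := by unfold fluxConst; positivity
  have hv := hsol.v_pos
  have hθ := hsol.θ_pos
  obtain ⟨hE, hD⟩ := energy_estimate_of_balance_law hT.le hconst hbalance
    (fun x t ht => hsol.hasDerivAt_energyFlux hT x ht) hsol.continuousOn_energyDensity
    (hsol.continuousOn_energyDensityDeriv.add hsol.continuousOn_dissipation)
    hsol.continuousOn_dissipation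
    (fun x t ht => energyDensity_nonneg (hv x t ht) (hθ x t ht) _ _ _)
    (fun x t ht => dissipation_nonneg hα (hv x t ht) (hθ x t ht) _ _ _ _ _)
    (fun x t ht κ hκ hκ1 => by
      obtain ⟨k1, k2, k3, k4, k5⟩ := hbd x t ht
      exact abs_energyFlux_le hα hβ hK (hv x t ht) (hθ x t ht) k1 k2 k3 k5 hκ hκ1 _ _ _ _)
    (fun ε hε => hsol.energyDensity_decay hε)
    (fun t ht => hsol.integrable_dissipation hα hβ ht) hfin
  intro t ht
  rw [he₀, two_mul]
  exact add_le_add (hE t ht) hD
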